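/- For every integer ℓ ≥ 3, there exists a positive integer N = N(ℓ) such that for every integer n ≥ N, rx_{3,ℓ}(K_{n,n}) = 4. -/

import Mathlib

open SimpleGraph

/-- `T` is a rainbow `S`-tree in `G` under edge-coloring `c`:
its vertices contain `S`, it is a tree, and `c` is injective on its edges. -/
def IsRainbowSTree {V β : Type*} (G : SimpleGraph V) (c : Sym2 V → β)
    (S : Set V) (T : G.Subgraph) : Prop :=
  S ⊆ T.verts ∧ T.coe.IsTree ∧ Set.InjOn c T.edgeSet

/-- A family of `S`-trees is internally disjoint: pairwise edge-disjoint, and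
the vertex sets of two distinct members meet exactly in `S`. -/
def InternallyDisjoint {V : Type*} {G : SimpleGraph V} (S : Set V)
    {ι : Type*} (T : ι → G.Subgraph) : Prop :=
  ∀ i j, i ≠ j → (T i).edgeSet ∩ (T j).edgeSet = ∅ ∧ (T i).verts ∩ (T j).verts = S

/-- The coloring `c` provides, for every set `S` of `k` vertices,
`ℓ` internally disjoint rainbow `S`-trees. -/
def HasRainbowSTrees {V β : Type*} (G : SimpleGraph V) (c : Sym2 V → β) (k ℓ : ℕ) : Prop :=
  ∀ S : Finset V, S.card = k →
    ∃ T : Fin ℓ → G.Subgraph,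
      (∀ i, IsRainbowSTree G c (S : Set V) (T i)) ∧ InternallyDisjoint (S : Set V) T

/-- The `(k,ℓ)`-rainbow index `rx_{k,ℓ}(G)`: the minimum number `t` of colors such that
some edge-coloring of `G` with `t` colors gives, for every `k`-set `S`,
`ℓ` internally disjoint rainbow `S`-trees. -/
noncomputable def rainbowIndex {V : Type*} (G : SimpleGraph V) (k ℓ : ℕ) : ℕ :=
  sInf {t : ℕ | ∃ c : Sym2 V → Fin t, HasRainbowSTrees G c k ℓ}


/-- The pattern tree on five vertices. -/
def patTree (p : Bool) : SimpleGraph (Fin 5) :=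
  SimpleGraph.fromEdgeSet {s(0,1), s(0,2), s(0,3), s(if p then 0 else 3, 4)}

lemma patTree_edgeSet (p : Bool) : (patTree p).edgeSet =
    {s(0,1), s(0,2), s(0,3), s(if p then 0 else 3, 4)} := by
  rw [patTree, SimpleGraph.edgeSet_fromEdgeSet]
  ext e
  constructor
  · exact fun h => h.1
  · intro h
    refine ⟨h, ?_⟩
    rcases h with rfl | rfl | rfl | rfl <;> cases p <;> simp

lemma patTree_isTree (p : Bool) : (patTree p).IsTree := by
  rw [SimpleGraph.isTree_iff_connected_and_card]
  constructor
  · rw [SimpleGraph.connected_iff_exists_forall_reachable]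
    refine ⟨0, ?_⟩
    have h1 : (patTree p).Adj 0 1 := by simp [patTree]
    have h2 : (patTree p).Adj 0 2 := by simp [patTree]
    have h3 : (patTree p).Adj 0 3 := by simp [patTree]
    intro w
    fin_cases w
    · exact SimpleGraph.Reachable.refl _
    · exact h1.reachable
    · exact h2.reachable
    · exact h3.reachable
    · cases p
      · have h4 : (patTree false).Adj 3 4 := by simp [patTree]
        exact h3.reachable.trans h4.reachable
      · have h4 : (patTree true).Adj 0 4 := by simp [patTree]
        exact h4.reachable
  · rw [patTree_edgeSet]
    have : ({s(0,1), s(0,2), s(0,3), s(if p then 0 else 3, 4)} : Set (Sym2 (Fin 5))) =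
      (({s(0,1), s(0,2), s(0,3), s(if p then 0 else 3, 4)} : Finset (Sym2 (Fin 5))) : Set _) := by
      simp
    rw [this, Nat.card_coe_set_eq, Set.ncard_coe_finset]
    cases p <;> simp

lemma exists_subgraph {V : Type*} (G : SimpleGraph V) (p : Bool) (f : Fin 5 → V)
    (hf : Function.Injective f) (h1 : G.Adj (f 0) (f 1)) (h2 : G.Adj (f 0) (f 2))
    (h3 : G.Adj (f 0) (f 3)) (h4 : G.Adj (f (if p then 0 else 3)) (f 4)) :
    ∃ T : G.Subgraph, T.coe.IsTree ∧ T.verts = Set.range f ∧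
      T.edgeSet = {s(f 0, f 1), s(f 0, f 2), s(f 0, f 3), s(f (if p then 0 else 3), f 4)} := by
  let φ : patTree p →g G := ⟨f, by
    intro a b hab
    have : s(a,b) ∈ (patTree p).edgeSet := hab
    rw [patTree_edgeSet] at this
    change s(a,b).map f ∈ G.edgeSet
    rcases this with h | h | h | h <;> rw [h] <;> simpa⟩
  let C : SimpleGraph.Copy (patTree p) G := ⟨φ, hf⟩
  refine ⟨C.toSubgraph, (C.isoToSubgraph.isTree_iff).1 (patTree_isTree p), ?_, ?_⟩
  · simp [C, φ]
  · have : C.toSubgraph.edgeSet = Sym2.map f '' (patTree p).edgeSet := by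
      simp [SimpleGraph.Copy.toSubgraph]
      rfl
    rw [this, patTree_edgeSet]
    simp [Set.image_insert_eq]

lemma count_bad {E : Type*} [Fintype E] [DecidableEq E] (m : ℕ) (e : Fin m × Fin 4 → E)
    (he : Function.Injective e) :
    Fintype.card {c : E → Fin 4 // ∀ i, ¬ Function.Injective (fun k => c (e (i, k)))} * 256 ^ m
      ≤ 4 ^ Fintype.card E * 232 ^ m := by
  classical
  let B := {g : Fin 4 → Fin 4 // ¬ Function.Injective g}
  have hB : Fintype.card B = 232 := by decide +kernel
  let R := {x : E // x ∉ Set.range e}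
  have hR : Fintype.card R + 4 * m = Fintype.card E := by
    have h1 : Fintype.card R = Fintype.card E - Fintype.card {x : E // x ∈ Set.range e} :=
      Fintype.card_subtype_compl _
    have h2 : Fintype.card {x : E // x ∈ Set.range e} = m * 4 := by
      exact (Set.card_range_of_injective he).trans (by simp)
    have h3 := Fintype.card_subtype_le (fun x : E => x ∈ Set.range e)
    omega
  let Φ : {c : E → Fin 4 // ∀ i, ¬ Function.Injective (fun k => c (e (i, k)))} →
      (Fin m → B) × (R → Fin 4) :=
    fun c => (fun i => ⟨fun k => c.1 (e (i, k)), c.2 i⟩, fun x => c.1 x.1)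
  have hΦ : Function.Injective Φ := by
    intro c d h
    ext1
    funext x
    have h1 := congrArg Prod.fst h
    have h2 := congrArg Prod.snd h
    by_cases hx : x ∈ Set.range e
    · obtain ⟨⟨i, k⟩, rfl⟩ := hx
      exact congrFun (congrArg Subtype.val (congrFun h1 i)) k
    · exact congrFun h2 ⟨x, hx⟩
  have := Fintype.card_le_of_injective Φ hΦ
  rw [Fintype.card_prod, Fintype.card_fun, Fintype.card_fun, hB, Fintype.card_fin,
    Fintype.card_fin] at this
  calc _ ≤ _ := Nat.mul_le_mul_right _ this
    _ = _ := by
      rw [← hR, pow_add, pow_mul]; norm_num; ring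

lemma exists_good {E Q : Type*} [Fintype E] [DecidableEq E] [Fintype Q] (m : ℕ)
    (e : Q → Fin m × Fin 4 → E) (he : ∀ q, Function.Injective (e q))
    (hQ : Fintype.card Q * 232 ^ m < 256 ^ m) :
    ∃ c : E → Fin 4, ∀ q, ∃ i, Function.Injective (fun k => c (e q (i, k))) := by
  classical
  by_contra hcon
  push Not at hcon
  choose q hq using hcon
  let Ψ : (E → Fin 4) → Σ q : Q,
      {c : E → Fin 4 // ∀ i, ¬ Function.Injective (fun k => c (e q (i, k)))} :=
    fun c => ⟨q c, c, hq c⟩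
  have hΨ : Function.Injective Ψ := by
    intro c d h
    have : ((Ψ c).2.1) = (Ψ d).2.1 := by rw [h]
    exact this
  have h1 := Fintype.card_le_of_injective Ψ hΨ
  rw [Fintype.card_sigma, Fintype.card_fun, Fintype.card_fin] at h1
  have h2 : 4 ^ Fintype.card E * 256 ^ m ≤
      Fintype.card Q * (4 ^ Fintype.card E * 232 ^ m) := by
    calc _ ≤ _ := Nat.mul_le_mul_right _ h1
      _ = ∑ q : Q, Fintype.card
          {c : E → Fin 4 // ∀ i, ¬ Function.Injective (fun k => c (e q (i, k)))} * 256 ^ m := by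
        rw [Finset.sum_mul]
      _ ≤ ∑ q : Q, 4 ^ Fintype.card E * 232 ^ m :=
        Finset.sum_le_sum fun q _ => count_bad m (e q) (he q)
      _ = _ := by simp
  have h3 : 4 ^ Fintype.card E * 256 ^ m ≤
      4 ^ Fintype.card E * (Fintype.card Q * 232 ^ m) := by
    calc _ ≤ _ := h2
      _ = _ := by ring
  have := Nat.le_of_mul_le_mul_left h3 (by positivity)
  omega

lemma asymp (ℓ : ℕ) (hℓ : 3 ≤ ℓ) : ∃ N : ℕ, ∀ n, N ≤ n → ∃ m : ℕ, ℓ * m + 3 ≤ n ∧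
    ((2 * n) ^ 3 * ℓ) * 232 ^ m < 256 ^ m := by
  have ht := tendsto_pow_const_mul_const_pow_of_abs_lt_one 3 (r := (232 / 256 : ℝ))
    (by rw [abs_lt]; norm_num)
  have ht2 := (ht.const_mul ((2 * (2 * ℓ + 3 : ℝ)) ^ 3 * ℓ)).eventually_lt_const
    (u := 1) (by simp)
  obtain ⟨M, hM⟩ := Filter.eventually_atTop.1 ht2
  refine ⟨ℓ * (M + 1) + 3, fun n hn => ⟨(n - 3) / ℓ, ?_, ?_⟩⟩
  · have := Nat.mul_div_le (n - 3) ℓ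
    omega
  · set m := (n - 3) / ℓ with hm
    have hmM : M + 1 ≤ m := by
      rw [hm, Nat.le_div_iff_mul_le (by omega)]
      have : (M + 1) * ℓ = ℓ * (M + 1) := by ring
      omega
    have hn2 : n ≤ (2 * ℓ + 3) * m := by
      have h1 : n - 3 < ℓ * m + ℓ := by
        have := Nat.lt_mul_div_succ (n - 3) (b := ℓ) (by omega)
        rw [← hm] at this
        linarith
      have : n < ℓ * m + ℓ + 3 := by omega
      nlinarith
    have h := hM m (by omega)
    have hnR : (n : ℝ) ≤ (2 * ℓ + 3) * m := by exact_mod_cast hn2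
    have h5 : ((2 * n : ℝ)) ^ 3 * ℓ * (232 / 256) ^ m < 1 := by
      refine lt_of_le_of_lt ?_ h
      calc ((2 * n : ℝ)) ^ 3 * ℓ * (232 / 256) ^ m
          ≤ (2 * ((2 * ℓ + 3) * m) : ℝ) ^ 3 * ℓ * (232 / 256) ^ m := by gcongr
        _ = _ := by ring
    rw [div_pow, ← mul_div_assoc, div_lt_one (by positivity)] at h5
    exact_mod_cast h5

lemma exists_family {n ℓ m : ℕ} (hn : ℓ * m + 3 ≤ n) (a b d : Fin n ⊕ Fin n) (σ : Bool) :
    ∃ x : Fin ℓ × Fin m → Fin n ⊕ Fin n, Function.Injective x ∧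
      ∀ i, x i ≠ a ∧ x i ≠ b ∧ x i ≠ d ∧ (x i).isLeft = σ := by
  classical
  let A : Finset (Fin n ⊕ Fin n) := Finset.univ.filter (fun v => v.isLeft = σ)
  have hA : n ≤ A.card := by
    let g : Fin n → Fin n ⊕ Fin n := fun i => if σ then Sum.inl i else Sum.inr i
    have hg : Function.Injective g := by
      intro i j h
      cases σ <;> simpa [g] using h
    have : (Finset.univ.image g) ⊆ A := by
      intro v hv
      obtain ⟨i, -, rfl⟩ := Finset.mem_image.1 hv
      cases σ <;> simp [A, g]
    have h := Finset.card_le_card this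
    rwa [Finset.card_image_of_injective _ hg, Finset.card_univ, Fintype.card_fin] at h
  let F := A \ {a, b, d}
  have hF : ℓ * m ≤ F.card := by
    have h1 := Finset.le_card_sdiff ({a, b, d} : Finset (Fin n ⊕ Fin n)) A
    have h2 : ({a, b, d} : Finset (Fin n ⊕ Fin n)).card ≤ 3 := Finset.card_le_three
    change A.card - _ ≤ F.card at h1
    omega
  obtain ⟨φ⟩ : Nonempty ((Fin ℓ × Fin m) ↪ F) := by
    apply Function.Embedding.nonempty_of_card_le
    simpa using hF
  refine ⟨fun i => (φ i).1, fun i j h => φ.injective (Subtype.ext h), fun i => ?_⟩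
  have := (φ i).2
  simp only [F, A, Finset.mem_sdiff, Finset.mem_filter, Finset.mem_univ, true_and,
    Finset.mem_insert, Finset.mem_singleton, not_or] at this
  exact ⟨this.2.1, this.2.2.1, this.2.2.2, this.1⟩

/-- The four edges of the gadget. -/
def gadEdge {V : Type*} (a b d x w y : V) : Fin 4 → Sym2 V :=
  ![s(x, a), s(x, b), s(x, w), s(y, d)]

lemma gad_inj {V I : Type*} (side : V → Bool) (a b d : V) (x w : I → V) (hab : a ≠ b)
    (had : a ≠ d) (hbd : b ≠ d)
    (hx : Function.Injective x) (hw : Function.Injective w)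
    (hxs : ∀ i, x i ≠ a ∧ x i ≠ b ∧ x i ≠ d ∧ side (x i) = !side a)
    (hws : ∀ i, w i ≠ a ∧ w i ≠ b ∧ w i ≠ d ∧ side (w i) = side a) :
    Function.Injective (fun p : I × Fin 4 =>
      gadEdge a b d (x p.1) (w p.1) (if side d = side a then x p.1 else w p.1) p.2) := by
  have hxw : ∀ i j, x i ≠ w j := by
    intro i j h
    have h1 := (hxs i).2.2.2
    rw [h, (hws j).2.2.2] at h1
    cases h2 : side a <;> simp [h2] at h1
  rintro ⟨i, k⟩ ⟨j, l⟩ h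
  have X1 := hxs i
  have X2 := hxs j
  have W1 := hws i
  have W2 := hws j
  have h11 := hxw i j
  have h12 := hxw j i
  have h13 := hxw i i
  have h14 := hxw j j
  have hxi := @hx i j
  have hwi := @hw i j
  clear hxs hws hxw
  by_cases hs : side d = side a
  · simp only [hs, if_true] at h
    fin_cases k <;> fin_cases l <;> simp [gadEdge] at h ⊢ <;> grind
  · simp only [hs, if_false] at h
    fin_cases k <;> fin_cases l <;> simp [gadEdge] at h ⊢ <;> grind

lemma bip_adj {n : ℕ} {u v : Fin n ⊕ Fin n} (h : u.isLeft = !v.isLeft) :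
    (completeBipartiteGraph (Fin n) (Fin n)).Adj u v := by
  cases u <;> cases v <;> simp_all

set_option maxHeartbeats 1000000 in
lemma upper {n ℓ m : ℕ} (hn : ℓ * m + 3 ≤ n) (hm : ((2 * n) ^ 3 * ℓ) * 232 ^ m < 256 ^ m) :
    ∃ c : Sym2 (Fin n ⊕ Fin n) → Fin 4,
      HasRainbowSTrees (completeBipartiteGraph (Fin n) (Fin n)) c 3 ℓ := by
  classical
  let V := Fin n ⊕ Fin n
  let P := {t : V × V × V // t.1 ≠ t.2.1 ∧ t.1 ≠ t.2.2 ∧ t.2.1 ≠ t.2.2 ∧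
    t.2.1.isLeft = t.1.isLeft}
  choose x hx hxs using fun t : P =>
    exists_family (ℓ := ℓ) hn t.1.1 t.1.2.1 t.1.2.2 (!t.1.1.isLeft)
  choose w hw hws using fun t : P =>
    exists_family (ℓ := ℓ) hn t.1.1 t.1.2.1 t.1.2.2 (t.1.1.isLeft)
  let y : P → Fin ℓ × Fin m → V := fun t i =>
    if t.1.2.2.isLeft = t.1.1.isLeft then x t i else w t i
  have hinj := fun t : P => gad_inj (fun v : V => v.isLeft) t.1.1 t.1.2.1 t.1.2.2 (x t) (w t)
    t.2.1 t.2.2.1 t.2.2.2.1 (hx t) (hw t) (hxs t) (hws t)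
  let e : P × Fin ℓ → Fin m × Fin 4 → Sym2 V := fun q p =>
    gadEdge q.1.1.1 q.1.1.2.1 q.1.1.2.2 (x q.1 (q.2, p.1)) (w q.1 (q.2, p.1))
      (y q.1 (q.2, p.1)) p.2
  have he : ∀ q, Function.Injective (e q) := by
    rintro ⟨t, b⟩ ⟨i, k⟩ ⟨j, l⟩ h
    have := @hinj t ((b, i), k) ((b, j), l) h
    simp at this
    simp [this]
  have hQ : Fintype.card (P × Fin ℓ) * 232 ^ m < 256 ^ m := by
    refine lt_of_le_of_lt (Nat.mul_le_mul_right _ ?_) hm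
    rw [Fintype.card_prod, Fintype.card_fin]
    refine Nat.mul_le_mul_right _ ?_
    refine (Fintype.card_subtype_le _).trans ?_
    simp only [V, Fintype.card_prod, Fintype.card_sum, Fintype.card_fin]
    apply le_of_eq
    ring
  obtain ⟨c, hc⟩ := exists_good m e he hQ
  refine ⟨c, fun S hS => ?_⟩
  obtain ⟨t, ht⟩ : ∃ t : P, S = {t.1.1, t.1.2.1, t.1.2.2} := by
    obtain ⟨a, b, d, hab, had, hbd, rfl⟩ := Finset.card_eq_three.1 hS
    by_cases h1 : b.isLeft = a.isLeft
    · exact ⟨⟨(a, b, d), hab, had, hbd, h1⟩, rfl⟩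
    by_cases h2 : d.isLeft = a.isLeft
    · refine ⟨⟨(a, d, b), had, hab, hbd.symm, h2⟩, ?_⟩
      ext v; simp; tauto
    · refine ⟨⟨(b, d, a), hbd, hab.symm, had.symm, ?_⟩, ?_⟩
      · change d.isLeft = b.isLeft
        cases h3 : a.isLeft <;> cases h4 : b.isLeft <;> cases h5 : d.isLeft <;> simp_all
      · ext v; simp; tauto
  choose i hi using fun j : Fin ℓ => hc (t, j)
  obtain ⟨⟨a, b, d⟩, hab, had, hbd, hside⟩ := t
  dsimp only at hab had hbd hside ht
  set t : P := ⟨⟨a, b, d⟩, hab, had, hbd, hside⟩ with htdef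
  let X : Fin ℓ → V := fun j => x t (j, i j)
  let W : Fin ℓ → V := fun j => w t (j, i j)
  have hX : Function.Injective X := fun j k h => congrArg Prod.fst (hx t h)
  have hW : Function.Injective W := fun j k h => congrArg Prod.fst (hw t h)
  have hXs : ∀ j, X j ≠ a ∧ X j ≠ b ∧ X j ≠ d ∧ (X j).isLeft = !a.isLeft := fun j => hxs t _
  have hWs : ∀ j, W j ≠ a ∧ W j ≠ b ∧ W j ≠ d ∧ (W j).isLeft = a.isLeft := fun j => hws t _
  have hXW : ∀ j k, X j ≠ W k := by
    intro j k h
    have h1 := (hXs j).2.2.2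
    rw [h, (hWs k).2.2.2] at h1
    cases h2 : a.isLeft <;> simp [h2] at h1
  let E : Fin ℓ → Fin 4 → Sym2 V := fun j =>
    gadEdge a b d (X j) (W j) (if d.isLeft = a.isLeft then X j else W j)
  have hE : ∀ j k j' k', E j k = E j' k' → j = j' := by
    intro j k j' k' h
    have := @gad_inj V (Fin ℓ) (fun v => v.isLeft) a b d X W hab had hbd hX hW hXs hWs
      (j, k) (j', k') h
    exact congrArg Prod.fst this
  have hcE : ∀ j, Function.Injective (fun k => c (E j k)) := fun j => hi j
  have hT : ∀ j, ∃ T : (completeBipartiteGraph (Fin n) (Fin n)).Subgraph,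
      T.coe.IsTree ∧ T.verts = {X j, a, b, W j, d} ∧ T.edgeSet = Set.range (E j) := by
    intro j
    obtain ⟨X1, X2, X3, X4⟩ := hXs j
    obtain ⟨W1, W2, W3, W4⟩ := hWs j
    have h0 := hXW j j
    let f : Fin 5 → V := ![X j, a, b, W j, d]
    have hf : Function.Injective f := by
      intro p q h
      fin_cases p <;> fin_cases q <;> simp [f] at h ⊢ <;> grind
    obtain ⟨T, hT1, hT2, hT3⟩ := exists_subgraph (completeBipartiteGraph (Fin n) (Fin n))
      (decide (d.isLeft = a.isLeft)) f hf (bip_adj X4)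
      (bip_adj (by change (X j).isLeft = !b.isLeft; rw [X4, hside]))
      (bip_adj (by change (X j).isLeft = !(W j).isLeft; rw [X4, W4]))
      (by
        apply bip_adj
        by_cases hs : d.isLeft = a.isLeft
        · simp only [hs, decide_true, if_true]
          change (X j).isLeft = !d.isLeft
          rw [X4, hs]
        · simp only [hs, decide_false]
          change (W j).isLeft = !d.isLeft
          rw [W4]
          cases h1 : d.isLeft <;> cases h2 : a.isLeft <;> simp_all)
    refine ⟨T, hT1, ?_, ?_⟩
    · rw [hT2]
      ext v
      constructor
      · rintro ⟨p, rfl⟩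
        fin_cases p <;> simp [f]
      · rintro (h | h | h | h | h)
        · exact ⟨0, h.symm⟩
        · exact ⟨1, h.symm⟩
        · exact ⟨2, h.symm⟩
        · exact ⟨3, h.symm⟩
        · exact ⟨4, h.symm⟩
    · rw [hT3]
      have h3 : s(f (if decide (d.isLeft = a.isLeft) then 0 else 3), f 4) = E j 3 := by
        by_cases hs : d.isLeft = a.isLeft <;> simp [f, E, gadEdge, hs]
      rw [h3]
      ext v
      constructor
      · rintro (h | h | h | h)
        · exact ⟨0, h.symm⟩
        · exact ⟨1, h.symm⟩
        · exact ⟨2, h.symm⟩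
        · exact ⟨3, h.symm⟩
      · rintro ⟨p, rfl⟩
        fin_cases p
        · exact Or.inl rfl
        · exact Or.inr (Or.inl rfl)
        · exact Or.inr (Or.inr (Or.inl rfl))
        · exact Or.inr (Or.inr (Or.inr rfl))
  choose T hT1 hT2 hT3 using hT
  refine ⟨T, fun j => ⟨?_, hT1 j, ?_⟩, fun j k hjk => ⟨?_, ?_⟩⟩
  · rw [hT2, ht]
    intro v hv
    simp at hv ⊢
    tauto
  · rw [hT3]
    rintro _ ⟨p, rfl⟩ _ ⟨q, rfl⟩ h
    rw [hcE j h]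
  · rw [hT3, hT3, Set.eq_empty_iff_forall_notMem]
    rintro v ⟨⟨p, rfl⟩, ⟨q, hq⟩⟩
    exact hjk (hE _ _ _ _ hq).symm
  · rw [hT2, hT2, ht]
    have h1 := hXW j k
    have h2 := hXW k j
    have h3 : X j ≠ X k := fun h => hjk (hX h)
    have h4 : W j ≠ W k := fun h => hjk (hW h)
    ext v
    simp only [Set.mem_inter_iff, Set.mem_insert_iff, Set.mem_singleton_iff, Finset.coe_insert,
      Finset.coe_singleton]
    have := hXs j
    have := hXs k
    have := hWs j
    have := hWs k
    grind

lemma lower_tree {n t : ℕ} (ht : t < 4) (c : Sym2 (Fin n ⊕ Fin n) → Fin t) (u₁ u₂ v : Fin n)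
    (hu : u₁ ≠ u₂) (S : Set (Fin n ⊕ Fin n)) (hS : S = {Sum.inl u₁, Sum.inl u₂, Sum.inr v})
    (T : (completeBipartiteGraph (Fin n) (Fin n)).Subgraph)
    (hT : IsRainbowSTree (completeBipartiteGraph (Fin n) (Fin n)) c S T) :
    T.Adj (Sum.inl u₁) (Sum.inr v) ∨ T.Adj (Sum.inl u₂) (Sum.inr v) := by
  classical
  obtain ⟨hST, htree, hinj⟩ := hT
  have hm1 : Sum.inl u₁ ∈ T.verts := hST (by simp [hS])
  have hm2 : Sum.inl u₂ ∈ T.verts := hST (by simp [hS])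
  have hm3 : Sum.inr v ∈ T.verts := hST (by simp [hS])
  by_contra hcon
  push Not at hcon
  have : Nontrivial T.verts := ⟨⟨⟨_, hm1⟩, ⟨_, hm3⟩, by simp⟩⟩
  obtain ⟨⟨w, hwT⟩, hw⟩ := htree.connected.preconnected.exists_adj_of_nontrivial ⟨_, hm3⟩
  obtain ⟨⟨x, hxT⟩, hx⟩ := htree.connected.preconnected.exists_adj_of_nontrivial ⟨_, hm1⟩
  simp only [SimpleGraph.Subgraph.coe_adj] at hw hx
  have hwG := hw.adj_sub
  have hxG := hx.adj_sub
  rcases w with w | w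
  swap
  · simp at hwG
  rcases x with x | x
  · simp at hxG
  have hw1 : w ≠ u₁ := by rintro rfl; exact hcon.1 hw.symm
  have hw2 : w ≠ u₂ := by rintro rfl; exact hcon.2 hw.symm
  have hxv : x ≠ v := by rintro rfl; exact hcon.1 hx
  have hcard := (SimpleGraph.isTree_iff_connected_and_card.1 htree).2
  have hle : Nat.card T.coe.edgeSet ≤ 3 := by
    let g : T.coe.edgeSet → Fin t := fun e => c (e.1.map Subtype.val)
    have hmem : ∀ e : T.coe.edgeSet, e.1.map Subtype.val ∈ T.edgeSet := by
      rintro ⟨e, he⟩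
      induction e using Sym2.ind with
      | _ p q => exact he
    have hg : Function.Injective g := by
      intro e e' h
      have := hinj (hmem e) (hmem e') h
      exact Subtype.ext (Sym2.map.injective Subtype.val_injective this)
    have := Nat.card_le_card_of_injective g hg
    rw [Nat.card_fin] at this
    omega
  have h5 : ({Sum.inl u₁, Sum.inl u₂, Sum.inr v, Sum.inl w, Sum.inr x} :
      Finset (Fin n ⊕ Fin n)).card = 5 := by
    repeat rw [Finset.card_insert_of_notMem]
    all_goals simp
    all_goals grind
  have h6 : (({Sum.inl u₁, Sum.inl u₂, Sum.inr v, Sum.inl w, Sum.inr x} :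
      Finset (Fin n ⊕ Fin n)) : Set (Fin n ⊕ Fin n)) ⊆ T.verts := by
    intro z hz
    simp at hz
    rcases hz with rfl | rfl | rfl | rfl | rfl <;> assumption
  have h7 := Set.ncard_le_ncard h6 (Set.toFinite _)
  rw [Set.ncard_coe_finset, h5, ← Nat.card_coe_set_eq] at h7
  omega

lemma lower {n ℓ t : ℕ} (hn : 2 ≤ n) (hℓ : 3 ≤ ℓ) (ht : t < 4)
    (c : Sym2 (Fin n ⊕ Fin n) → Fin t) :
    ¬ HasRainbowSTrees (completeBipartiteGraph (Fin n) (Fin n)) c 3 ℓ := by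
  classical
  intro H
  let u₁ : Fin n := ⟨0, by omega⟩
  let u₂ : Fin n := ⟨1, by omega⟩
  have hu : u₁ ≠ u₂ := by simp [u₁, u₂]
  obtain ⟨T, hT, hD⟩ := H {Sum.inl u₁, Sum.inl u₂, Sum.inr u₁} (by
    rw [Finset.card_eq_three]
    exact ⟨_, _, _, by simpa using hu, by simp, by simp, rfl⟩)
  have key := fun i => lower_tree ht c u₁ u₂ u₁ hu _ (by simp) (T i) (hT i)
  have hno : ∀ i j, i ≠ j → ∀ p q, (T i).Adj p q → (T j).Adj p q → False := by
    intro i j hij p q h1 h2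
    have : s(p, q) ∈ (T i).edgeSet ∩ (T j).edgeSet := ⟨h1, h2⟩
    rw [(hD i j hij).1] at this
    exact this
  let i0 : Fin ℓ := ⟨0, by omega⟩
  let i1 : Fin ℓ := ⟨1, by omega⟩
  let i2 : Fin ℓ := ⟨2, by omega⟩
  have h01 := hno i0 i1 (by simp [i0, i1])
  have h02 := hno i0 i2 (by simp [i0, i2])
  have h12 := hno i1 i2 (by simp [i1, i2])
  rcases key i0 with k0 | k0 <;> rcases key i1 with k1 | k1 <;> rcases key i2 with k2 | k2 <;>
    first
    | exact h01 _ _ k0 k1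
    | exact h02 _ _ k0 k2
    | exact h12 _ _ k1 k2

theorem rx3l_Knn_eq_four (ℓ : ℕ) (hℓ : 3 ≤ ℓ) :
    ∃ N : ℕ, 0 < N ∧ ∀ n : ℕ, N ≤ n →
      rainbowIndex (completeBipartiteGraph (Fin n) (Fin n)) 3 ℓ = 4 := by
  obtain ⟨N, hN⟩ := asymp ℓ hℓ
  refine ⟨N + 2, by omega, fun n hn => ?_⟩
  obtain ⟨m, hm1, hm2⟩ := hN n (by omega)
  obtain ⟨c, hc⟩ := upper hm1 hm2
  apply le_antisymm
  · exact Nat.sInf_le ⟨c, hc⟩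
  · refine le_csInf (s := {t : ℕ | ∃ c : Sym2 (Fin n ⊕ Fin n) → Fin t, HasRainbowSTrees
      (completeBipartiteGraph (Fin n) (Fin n)) c 3 ℓ}) ⟨4, c, hc⟩ ?_
    rintro t ⟨c', hc'⟩
    by_contra hlt
    exact lower (by omega) hℓ (by omega) c' hc'
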